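/- arXiv:1702.03639 — 5 statements merged into one kernel-verified Lean document; each statement's English description precedes it below -/
import Mathlib

section
/- Let β ∈ (0,1) and let s ∈ ℂ with Re s ≥ 0 and s ≠ 0. Then ∫₀^∞ (e^{-sx} − 1) x^{-1-β} dx = Γ(−β) s^β, where s^β = exp(β log s) is the principal branch of the complex power and Γ(−β) is the (real) Gamma function evaluated at −β. -/
open MeasureTheory

theorem Complex.norm_exp_sub_one_le_norm {z : ℂ} (hz : z.re ≤ 0) :
    ‖Complex.exp z - 1‖ ≤ ‖z‖ := by
  have h := (convex_halfSpace_re_le 0).norm_image_sub_le_of_norm_deriv_le (𝕜 := ℂ)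
    (f := Complex.exp) (C := 1) (x := 0) (y := z)
    (fun w _ => Complex.differentiableAt_exp)
    (fun w hw => by
      rw [Complex.deriv_exp, Complex.norm_exp]
      exact Real.exp_le_one_iff.2 hw) (by simp) hz
  simpa using h

theorem norm_exp_neg_mul_sub_one_le {s : ℂ} (hs : 0 ≤ s.re) {x : ℝ} (hx : 0 ≤ x) :
    ‖Complex.exp (-s * x) - 1‖ ≤ min 2 (‖s‖ * x) := by
  have hre : (-s * x).re ≤ 0 := by
    simpa using mul_nonneg hs hx
  refine le_min ?_ ?_
  · refine (norm_sub_le _ _).trans ?_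
    rw [Complex.norm_exp, norm_one]
    linarith [Real.exp_le_one_iff.2 hre]
  · simpa [abs_of_nonneg hx] using Complex.norm_exp_sub_one_le_norm hre

theorem integrableOn_min_mul_rpow {β : ℝ} (hβ : β ∈ Set.Ioo (0 : ℝ) 1) (c : ℝ) (hc : 0 ≤ c) :
    IntegrableOn (fun x : ℝ => min 2 (c * x) * x ^ (-1 - β)) (Set.Ioi 0) := by
  obtain ⟨h0, h1⟩ := hβ
  have hmeas : Measurable fun x : ℝ => min 2 (c * x) * x ^ (-1 - β) := by fun_prop
  rw [← Set.Ioc_union_Ioi_eq_Ioi zero_le_one]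
  refine IntegrableOn.union ?_ ?_
  · have hi : IntegrableOn (fun x : ℝ => c * x ^ (-β)) (Set.Ioc 0 1) :=
      ((intervalIntegrable_iff_integrableOn_Ioc_of_le zero_le_one).1
        (intervalIntegral.intervalIntegrable_rpow' (by linarith))).const_mul c
    refine hi.mono' hmeas.aestronglyMeasurable
      ((ae_restrict_mem measurableSet_Ioc).mono fun x hx => ?_)
    have hx0 : 0 < x := hx.1
    rw [Real.norm_of_nonneg (by positivity)]
    calc min 2 (c * x) * x ^ (-1 - β) ≤ c * x * x ^ (-1 - β) := by gcongr; exact min_le_right _ _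
      _ = c * x ^ (-β) := by
        rw [mul_assoc, ← Real.rpow_one_add' hx0.le (by linarith)]
        ring_nf
  · have hi : IntegrableOn (fun x : ℝ => 2 * x ^ (-1 - β)) (Set.Ioi 1) :=
      (integrableOn_Ioi_rpow_of_lt (by linarith) zero_lt_one).const_mul 2
    refine hi.mono' hmeas.aestronglyMeasurable
      ((ae_restrict_mem measurableSet_Ioi).mono fun x hx => ?_)
    have hx0 : 0 < x := zero_lt_one.trans hx
    rw [Real.norm_of_nonneg (by positivity)]
    gcongr
    exact min_le_left _ _

theorem norm_exp_sub_one_mul_rpow_le {β c : ℝ} {s : ℂ} (hs : 0 ≤ s.re) (hsc : ‖s‖ ≤ c)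
    {x : ℝ} (hx : 0 ≤ x) :
    ‖(Complex.exp (-s * x) - 1) * ((x ^ (-1 - β) : ℝ) : ℂ)‖ ≤
      min 2 (c * x) * x ^ (-1 - β) := by
  rw [norm_mul, Complex.norm_real, Real.norm_of_nonneg (by positivity)]
  gcongr
  exact (norm_exp_neg_mul_sub_one_le hs hx).trans (by gcongr)

theorem integrableOn_exp_sub_one_mul_rpow {β : ℝ} (hβ : β ∈ Set.Ioo (0 : ℝ) 1) {s : ℂ}
    (hs : 0 ≤ s.re) :
    IntegrableOn (fun x : ℝ => (Complex.exp (-s * x) - 1) * ((x ^ (-1 - β) : ℝ) : ℂ))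
      (Set.Ioi 0) :=
  (integrableOn_min_mul_rpow hβ ‖s‖ (norm_nonneg s)).mono'
    (Measurable.aestronglyMeasurable (by fun_prop))
    ((ae_restrict_mem measurableSet_Ioi).mono fun _ hx =>
      norm_exp_sub_one_mul_rpow_le hs le_rfl (le_of_lt hx))

theorem continuousOn_integral_exp_sub_one_mul_rpow {β : ℝ} (hβ : β ∈ Set.Ioo (0 : ℝ) 1) :
    ContinuousOn
      (fun s : ℂ => ∫ x in Set.Ioi (0 : ℝ),
        (Complex.exp (-s * x) - 1) * ((x ^ (-1 - β) : ℝ) : ℂ)) {s | 0 ≤ s.re} := by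
  intro s _
  refine continuousWithinAt_of_dominated
    (bound := fun x : ℝ => min 2 ((‖s‖ + 1) * x) * x ^ (-1 - β))
    (.of_forall fun w => Measurable.aestronglyMeasurable (by fun_prop)) ?_
    (integrableOn_min_mul_rpow hβ _ (by positivity))
    (.of_forall fun x => by fun_prop)
  filter_upwards [self_mem_nhdsWithin,
    mem_nhdsWithin_of_mem_nhds (Metric.ball_mem_nhds s one_pos)] with w hw hws
  refine (ae_restrict_mem measurableSet_Ioi).mono fun x hx =>
    norm_exp_sub_one_mul_rpow_le hw ?_ (le_of_lt hx)
  linarith [norm_le_norm_add_norm_sub' w s, mem_ball_iff_norm.1 hws]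

theorem differentiableOn_integral_exp_sub_one_mul_rpow {β : ℝ} (hβ : β ∈ Set.Ioo (0 : ℝ) 1) :
    DifferentiableOn ℂ
      (fun s : ℂ => ∫ x in Set.Ioi (0 : ℝ),
        (Complex.exp (-s * x) - 1) * ((x ^ (-1 - β) : ℝ) : ℂ)) {s | 0 < s.re} := by
  intro s hs
  have hs : 0 < s.re := hs
  have hU : {w : ℂ | s.re / 2 < w.re} ∈ nhds s :=
    (isOpen_lt continuous_const Complex.continuous_re).mem_nhds (half_lt_self hs)
  refine (hasDerivAt_integral_of_dominated_loc_of_deriv_le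
    (F := fun (w : ℂ) (x : ℝ) => (Complex.exp (-w * x) - 1) * ((x ^ (-1 - β) : ℝ) : ℂ))
    (F' := fun (w : ℂ) (x : ℝ) =>
      Complex.exp (-w * x) * (-1 * x) * ((x ^ (-1 - β) : ℝ) : ℂ))
    (bound := fun x : ℝ => x ^ (-β) * Real.exp (-(s.re / 2) * x ^ (1 : ℝ))) hU
    (.of_forall fun w => Measurable.aestronglyMeasurable (by fun_prop))
    (integrableOn_exp_sub_one_mul_rpow hβ hs.le)
    (Measurable.aestronglyMeasurable (by fun_prop)) ?_
    (integrableOn_rpow_mul_exp_neg_mul_rpow (by linarith [hβ.2]) one_pos (half_pos hs))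
    ?_).2.differentiableAt.differentiableWithinAt
  · refine (ae_restrict_mem measurableSet_Ioi).mono fun x hx w hw => ?_
    have hx : 0 < x := hx
    have hw : s.re / 2 < w.re := hw
    have hpow : x * x ^ (-1 - β) = x ^ (-β) := by
      rw [← Real.rpow_one_add' hx.le (by linarith [hβ.1])]
      ring_nf
    rw [norm_mul, norm_mul, Complex.norm_exp, Complex.norm_real,
      Real.norm_of_nonneg (by positivity : 0 ≤ x ^ (-1 - β)), Real.rpow_one]
    have : ‖(-1 * x : ℂ)‖ = x := by simp [abs_of_pos hx]
    rw [this, mul_assoc, hpow, mul_comm]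
    gcongr
    simp only [Complex.mul_re, Complex.neg_re, Complex.ofReal_re, Complex.ofReal_im, mul_zero,
      sub_zero]
    nlinarith
  · refine .of_forall fun x w _ => ?_
    exact ((((hasDerivAt_id w).neg.mul_const (x : ℂ)).cexp).sub_const 1).mul_const _

theorem integral_exp_sub_one_mul_rpow_of_pos {β : ℝ} (hβ : β ∈ Set.Ioo (0 : ℝ) 1) {r : ℝ}
    (hr : 0 < r) :
    ∫ x in Set.Ioi (0 : ℝ), (Real.exp (-r * x) - 1) * x ^ (-1 - β) =
      Real.Gamma (-β) * r ^ β := by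
  obtain ⟨h0, h1⟩ := id hβ
  have hbound : ∀ x : ℝ, 0 < x → |Real.exp (-r * x) - 1| ≤ min 2 (r * x) := fun x hx => by
    have h := norm_exp_neg_mul_sub_one_le (s := r) (by simpa using hr.le) hx.le
    rw [Complex.norm_real, Real.norm_of_nonneg hr.le] at h
    rw [← Real.norm_eq_abs, ← Complex.norm_real]
    simpa using h
  have hGamma : Real.Gamma (1 - β) = -β * Real.Gamma (-β) := by
    rw [← Real.Gamma_add_one (by linarith)]
    ring_nf
  have hgi := Real.integral_rpow_mul_exp_neg_mul_Ioi (sub_pos.2 h1) hr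
  have hint : IntegrableOn (fun x : ℝ => (Real.exp (-r * x) - 1) * x ^ (-1 - β))
      (Set.Ioi 0) := by
    refine (integrableOn_min_mul_rpow hβ r hr.le).mono'
      (Measurable.aestronglyMeasurable (by fun_prop))
      ((ae_restrict_mem measurableSet_Ioi).mono fun x hx => ?_)
    have hx : 0 < x := hx
    rw [norm_mul, Real.norm_of_nonneg (by positivity : 0 ≤ x ^ (-1 - β))]
    gcongr
    exact hbound x hx
  have hint' : IntegrableOn (fun x : ℝ => Real.exp (-r * x) * (-r * 1) * (x ^ (-β) / (-β)))
      (Set.Ioi 0) := by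
    refine IntegrableOn.congr_fun ((integrableOn_rpow_mul_exp_neg_mul_rpow (p := 1) (s := -β)
      (b := r) (by linarith) one_pos hr).const_mul (r / β)) (fun x _ => ?_) measurableSet_Ioi
    simp only [Real.rpow_one]
    field_simp
  have hparts := integral_Ioi_mul_deriv_eq_deriv_mul (a := (0 : ℝ)) (a' := (0 : ℝ))
    (b' := (0 : ℝ))
    (u := fun x : ℝ => Real.exp (-r * x) - 1) (v := fun x : ℝ => x ^ (-β) / (-β))
    (u' := fun x : ℝ => Real.exp (-r * x) * (-r * 1)) (v' := fun x : ℝ => x ^ (-1 - β))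
    (fun x _ => (((hasDerivAt_id x).const_mul (-r)).exp).sub_const 1)
    (fun x hx => by
      convert (Real.hasDerivAt_rpow_const (p := -β) (Or.inl (ne_of_gt hx))).div_const (-β) using 1
      field_simp
      ring_nf)
    hint hint' ?_ ?_
  · rw [hparts]
    have : ∫ x in Set.Ioi (0 : ℝ), Real.exp (-r * x) * (-r * 1) * (x ^ (-β) / (-β)) =
        ∫ x in Set.Ioi (0 : ℝ), r / β * (x ^ (1 - β - 1) * Real.exp (-(r * x))) := by
      refine setIntegral_congr_fun measurableSet_Ioi fun x _ => ?_
      simp only [show 1 - β - 1 = -β by ring, neg_mul]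
      field_simp
    rw [this, integral_const_mul, hgi, hGamma, one_div, Real.inv_rpow hr.le,
      Real.rpow_sub hr, Real.rpow_one]
    field_simp
    ring
  · refine squeeze_zero_norm' (a := fun x : ℝ => r / β * x ^ (1 - β)) ?_ ?_
    · filter_upwards [self_mem_nhdsWithin] with x hx
      have hx : 0 < x := hx
      have hb := (hbound x hx).trans (min_le_right _ _)
      rw [Pi.mul_apply, norm_mul, norm_div, norm_neg, Real.norm_of_nonneg h0.le,
        Real.norm_of_nonneg (by positivity : 0 ≤ x ^ (-β)), Real.norm_eq_abs]
      calc _ ≤ r * x * (x ^ (-β) / β) := by gcongr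
        _ = r / β * (x * x ^ (-β)) := by ring
        _ = _ := by
          rw [← Real.rpow_one_add' hx.le (by linarith)]
          ring_nf
    · have h : Filter.Tendsto (fun x : ℝ => r / β * x ^ (1 - β)) (nhds 0)
          (nhds (r / β * 0 ^ (1 - β))) :=
        ((Real.continuousAt_rpow_const 0 (1 - β) (Or.inr (by linarith))).const_mul
          (r / β)).tendsto
      rw [Real.zero_rpow (by linarith), mul_zero] at h
      exact h.mono_left nhdsWithin_le_nhds
  · refine squeeze_zero_norm' (a := fun x : ℝ => 2 / β * x ^ (-β)) ?_ ?_
    · filter_upwards [Filter.eventually_gt_atTop 0] with x hx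
      have hb := (hbound x hx).trans (min_le_left _ _)
      rw [Pi.mul_apply, norm_mul, norm_div, norm_neg, Real.norm_of_nonneg h0.le,
        Real.norm_of_nonneg (by positivity : 0 ≤ x ^ (-β)), Real.norm_eq_abs]
      calc _ ≤ 2 * (x ^ (-β) / β) := by gcongr
        _ = _ := by ring
    · simpa using (tendsto_rpow_neg_atTop h0).const_mul (2 / β)

theorem integral_exp_sub_one_mul_rpow_of_re_pos {β : ℝ} (hβ : β ∈ Set.Ioo (0 : ℝ) 1) {s : ℂ}
    (hs : 0 < s.re) :
    ∫ x in Set.Ioi (0 : ℝ), (Complex.exp (-s * x) - 1) * ((x ^ (-1 - β) : ℝ) : ℂ)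
      = (Real.Gamma (-β) : ℂ) * s ^ (β : ℂ) := by
  have hopen : IsOpen {s : ℂ | 0 < s.re} := isOpen_lt continuous_const Complex.continuous_re
  have hpow : DifferentiableOn ℂ (fun s : ℂ => (Real.Gamma (-β) : ℂ) * s ^ (β : ℂ))
      {s | 0 < s.re} := fun w hw =>
    ((differentiableAt_id.cpow_const (Or.inl hw)).const_mul _).differentiableWithinAt
  refine ((differentiableOn_integral_exp_sub_one_mul_rpow hβ).analyticOnNhd
    hopen).eqOn_of_preconnected_of_frequently_eq (hpow.analyticOnNhd hopen)
    (convex_halfSpace_re_gt 0).isPreconnected (z₀ := 1) (by simp) ?_ hs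
  have hreal : ∀ r : ℝ, 0 < r →
      ∫ x in Set.Ioi (0 : ℝ), (Complex.exp (-(r : ℂ) * x) - 1) * ((x ^ (-1 - β) : ℝ) : ℂ)
        = (Real.Gamma (-β) : ℂ) * (r : ℂ) ^ (β : ℂ) := fun r hr => by
    rw [← Complex.ofReal_cpow hr.le, ← Complex.ofReal_mul,
      ← integral_exp_sub_one_mul_rpow_of_pos hβ hr, ← integral_complex_ofReal]
    push_cast
    rfl
  have htend : Filter.Tendsto (fun r : ℝ => (r : ℂ)) (nhdsWithin 1 {1}ᶜ)
      (nhdsWithin 1 {1}ᶜ) := by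
    refine tendsto_nhdsWithin_iff.2 ⟨?_, ?_⟩
    · simpa using (Complex.continuous_ofReal.tendsto 1).mono_left nhdsWithin_le_nhds
    · filter_upwards [self_mem_nhdsWithin] with r hr
      simpa using hr
  refine htend.frequently (Filter.Eventually.frequently ?_)
  filter_upwards [mem_nhdsWithin_of_mem_nhds (lt_mem_nhds (zero_lt_one (α := ℝ)))] with r hr
  exact hreal r hr

/-- For `β ∈ (0,1)` and `s ∈ ℂ` with `Re s ≥ 0`, `s ≠ 0`:
`∫₀^∞ (e^{-sx} − 1) x^{-1-β} dx = Γ(−β) s^β` (principal branch power). -/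
theorem integral_exp_sub_one_rpow
    (β : ℝ) (hβ : β ∈ Set.Ioo (0:ℝ) 1) (s : ℂ) (hs : 0 ≤ s.re) (hs0 : s ≠ 0) :
    ∫ x in Set.Ioi (0:ℝ), (Complex.exp (-s * x) - 1) * ((x ^ (-1 - β) : ℝ) : ℂ)
      = (Real.Gamma (-β) : ℂ) * s ^ (β : ℂ) := by
  have hslit : s ∈ Complex.slitPlane := by
    rcases hs.lt_or_eq with h | h
    · exact Or.inl h
    · exact Or.inr fun him => hs0 (Complex.ext h.symm him)
  have hpath : Filter.Tendsto (fun ε : ℝ => s + ε) (nhdsWithin 0 (Set.Ioi 0)) (nhds s) := by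
    have h : Continuous fun ε : ℝ => s + ε := by fun_prop
    simpa using (h.tendsto 0).mono_left nhdsWithin_le_nhds
  have hre : ∀ᶠ ε : ℝ in nhdsWithin 0 (Set.Ioi 0), 0 < (s + ε).re := by
    filter_upwards [self_mem_nhdsWithin] with ε hε
    simpa using add_pos_of_nonneg_of_pos hs hε
  have hleft := (continuousOn_integral_exp_sub_one_mul_rpow hβ s hs).tendsto.comp
    (tendsto_nhdsWithin_iff.2 ⟨hpath, hre.mono fun _ h => h.le⟩)
  have hright := ((continuousAt_cpow_const (b := (β : ℂ)) hslit).const_mul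
    (Real.Gamma (-β) : ℂ)).tendsto.comp hpath
  refine tendsto_nhds_unique_of_eventuallyEq hleft hright ?_
  filter_upwards [hre] with ε hε
  exact integral_exp_sub_one_mul_rpow_of_re_pos hβ hε
end

section
/- Let β ∈ (1,2) and let s ∈ ℂ with Re s ≥ 0 and s ≠ 0. Then ∫₀^∞ (e^{-sx} − 1 + sx) x^{-1-β} dx = Γ(−β) s^β, where s^β = exp(β log s) is the principal branch of the complex power and Γ(−β) is the (real) Gamma function evaluated at −β. -/
open MeasureTheory

open Set Filter Topology

/-- For `0 ≤ Re z`, the second-order Taylor remainder of `exp (-z)` is bounded by `3 ‖z‖²`. -/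
lemma norm_exp_neg_sub_one_add_le_sq {z : ℂ} (hz : 0 ≤ z.re) :
    ‖Complex.exp (-z) - 1 + z‖ ≤ 3 * ‖z‖ ^ 2 := by
  rcases le_total ‖z‖ 1 with h | h
  · have := Complex.norm_exp_sub_one_sub_id_le (x := -z) (by simpa using h)
    rw [norm_neg, sub_neg_eq_add] at this
    nlinarith [sq_nonneg ‖z‖]
  · have h1 : ‖Complex.exp (-z)‖ ≤ 1 := by simpa [Complex.norm_exp] using hz
    have h2 := norm_add_le (Complex.exp (-z) - 1) z
    have h3 := norm_sub_le (Complex.exp (-z)) 1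
    rw [norm_one] at h3
    nlinarith

/-- For `0 ≤ Re z`, the second-order Taylor remainder of `exp (-z)` is bounded by `3 ‖z‖`. -/
lemma norm_exp_neg_sub_one_add_le {z : ℂ} (hz : 0 ≤ z.re) :
    ‖Complex.exp (-z) - 1 + z‖ ≤ 3 * ‖z‖ := by
  rcases le_total ‖z‖ 1 with h | h
  · have := Complex.norm_exp_sub_one_sub_id_le (x := -z) (by simpa using h)
    rw [norm_neg, sub_neg_eq_add] at this
    nlinarith [norm_nonneg z]
  · have h1 : ‖Complex.exp (-z)‖ ≤ 1 := by simpa [Complex.norm_exp] using hz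
    have h2 := norm_add_le (Complex.exp (-z) - 1) z
    have h3 := norm_sub_le (Complex.exp (-z)) 1
    rw [norm_one] at h3
    linarith

lemma norm_one_sub_exp_neg_le_two {z : ℂ} (hz : 0 ≤ z.re) :
    ‖1 - Complex.exp (-z)‖ ≤ 2 := by
  have h1 : ‖Complex.exp (-z)‖ ≤ 1 := by simpa [Complex.norm_exp] using hz
  have h3 := norm_sub_le 1 (Complex.exp (-z))
  rw [norm_one] at h3
  linarith

lemma norm_one_sub_exp_neg_le {z : ℂ} (hz : 0 ≤ z.re) :
    ‖1 - Complex.exp (-z)‖ ≤ 2 * ‖z‖ := by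
  rcases le_total ‖z‖ 1 with h | h
  · have := Complex.norm_exp_sub_one_le (x := -z) (by simpa using h)
    rwa [norm_neg, norm_sub_rev] at this
  · linarith [norm_one_sub_exp_neg_le_two hz]

/-- The real integrability of `x ^ (a - 1) * exp (-r x)` on `(0, ∞)`. -/
lemma integrableOn_exp_neg_mul_mul_rpow {a r : ℝ} (ha : 0 < a) (hr : 0 < r) :
    IntegrableOn (fun x : ℝ ↦ Real.exp (-r * x) * x ^ (a - 1)) (Ioi 0) := by
  have h := integrableOn_rpow_mul_exp_neg_mul_rpow (p := 1) (s := a - 1) (b := r)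
    (by linarith) one_pos hr
  refine h.congr_fun (fun x _ ↦ ?_) measurableSet_Ioi
  simp [mul_comm]

/-- The Laplace transform of `x ^ (a - 1)` at a complex argument in the right half-plane. -/
lemma integral_cexp_neg_mul_mul_rpow {a : ℝ} (ha : 0 < a) {s : ℂ} (hs : 0 < s.re) :
    ∫ x in Ioi (0 : ℝ), Complex.exp (-s * x) * ((x ^ (a - 1) : ℝ) : ℂ)
      = Real.Gamma a * s ^ (-(a : ℂ)) := by
  set μ : Measure ℝ := (volume.restrict (Ioi (0 : ℝ))).withDensity
    (fun x ↦ ENNReal.ofReal (x ^ (a - 1))) with hμ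
  have hmeas : Measurable fun x : ℝ ↦ ENNReal.ofReal (x ^ (a - 1)) := by fun_prop
  have hlt : ∀ᵐ x ∂(volume.restrict (Ioi (0 : ℝ))), ENNReal.ofReal (x ^ (a - 1)) < ⊤ :=
    ae_of_all _ fun x ↦ ENNReal.ofReal_lt_top
  have hmgf (z : ℂ) : ProbabilityTheory.complexMGF id μ z =
      ∫ x in Ioi (0 : ℝ), Complex.exp (z * x) * ((x ^ (a - 1) : ℝ) : ℂ) := by
    rw [ProbabilityTheory.complexMGF, hμ, integral_withDensity_eq_integral_toReal_smul hmeas hlt]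
    refine setIntegral_congr_fun measurableSet_Ioi fun x hx ↦ ?_
    have : 0 ≤ x ^ (a - 1) := Real.rpow_nonneg (le_of_lt hx) _
    simp [ENNReal.toReal_ofReal this, mul_comm]
  have hset : Iio (0 : ℝ) ⊆ interior (ProbabilityTheory.integrableExpSet id μ) := by
    refine interior_maximal (fun t ht ↦ ?_) isOpen_Iio
    change Integrable (fun x ↦ Real.exp (t * id x)) μ
    rw [hμ, integrable_withDensity_iff hmeas hlt]
    refine (integrableOn_exp_neg_mul_mul_rpow ha (neg_pos.2 ht)).congr_fun (fun x hx ↦ ?_)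
      measurableSet_Ioi
    have : 0 ≤ x ^ (a - 1) := Real.rpow_nonneg (le_of_lt hx) _
    simp [ENNReal.toReal_ofReal this]
  let U : Set ℂ := {z | 0 < z.re}
  have hU : IsOpen U := isOpen_lt continuous_const Complex.continuous_re
  have hf : AnalyticOnNhd ℂ (fun z ↦ ProbabilityTheory.complexMGF id μ (-z)) U := by
    refine DifferentiableOn.analyticOnNhd (fun z hz ↦ ?_) hU
    have hz' : (-z).re ∈ interior (ProbabilityTheory.integrableExpSet id μ) :=
      hset (by simpa [U] using hz)
    have := (ProbabilityTheory.hasDerivAt_complexMGF hz').differentiableAt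
    exact (this.comp z differentiableAt_id.neg).differentiableWithinAt
  have hg : AnalyticOnNhd ℂ (fun z ↦ (Real.Gamma a : ℂ) * z ^ (-(a : ℂ))) U := by
    refine DifferentiableOn.analyticOnNhd (fun z hz ↦ ?_) hU
    have : DifferentiableAt ℂ (fun z : ℂ ↦ z ^ (-(a : ℂ))) z :=
      differentiableAt_id.cpow_const (Or.inl hz)
    exact (this.const_mul _).differentiableWithinAt
  have hreal (r : ℝ) (hr : 0 < r) : ProbabilityTheory.complexMGF id μ (-(r : ℂ)) =
      (Real.Gamma a : ℂ) * (r : ℂ) ^ (-(a : ℂ)) := by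
    have h := Complex.integral_cpow_mul_exp_neg_mul_Ioi (a := a) (by simpa using ha) hr
    rw [hmgf, ← Complex.Gamma_ofReal, mul_comm, Complex.cpow_neg, ← Complex.inv_cpow, ← one_div,
      ← h]
    · refine setIntegral_congr_fun measurableSet_Ioi fun x hx ↦ ?_
      rw [Complex.ofReal_cpow (le_of_lt hx), mul_comm]
      push_cast
      ring_nf
    · rw [Complex.arg_ofReal_of_nonneg hr.le]
      exact Real.pi_pos.ne
  have hfreq : ∃ᶠ z in 𝓝[≠] (1 : ℂ), ProbabilityTheory.complexMGF id μ (-z) =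
      (Real.Gamma a : ℂ) * z ^ (-(a : ℂ)) := by
    have ht : Tendsto (fun r : ℝ ↦ (r : ℂ)) (𝓝[>] 1) (𝓝[≠] 1) := by
      refine tendsto_nhdsWithin_iff.2 ⟨?_, ?_⟩
      · exact (Complex.continuous_ofReal.tendsto' 1 1 (by simp)).mono_left nhdsWithin_le_nhds
      · filter_upwards [self_mem_nhdsWithin] with r hr
        simpa using (ne_of_gt hr)
    refine ht.frequently (Eventually.frequently ?_)
    filter_upwards [self_mem_nhdsWithin] with r hr
    exact hreal r (one_pos.trans hr)
  have hconv : IsPreconnected U := (convex_halfSpace_re_gt 0).isPreconnected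
  have := hf.eqOn_of_preconnected_of_frequently_eq hg hconv (by simp [U]) hfreq hs
  exact (hmgf (-s)).symm.trans this

/-- The function equal to `x ^ (1 - β)` on `(0, 1]` and to `x ^ (-β)` beyond `1` is integrable. -/
lemma integrableOn_ite_rpow {β : ℝ} (hβ : β ∈ Ioo (1 : ℝ) 2) :
    IntegrableOn (fun x : ℝ ↦ if x ≤ 1 then x ^ (1 - β) else x ^ (-β)) (Ioi 0) := by
  rw [← Ioc_union_Ioi_eq_Ioi zero_le_one, integrableOn_union]
  constructor
  · have h : IntegrableOn (fun x : ℝ ↦ x ^ (1 - β)) (Ioc 0 1) :=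
      (intervalIntegrable_iff_integrableOn_Ioc_of_le zero_le_one).1
        (intervalIntegral.intervalIntegrable_rpow' (by linarith [hβ.2]))
    exact h.congr_fun (fun x hx ↦ by simp [hx.2]) measurableSet_Ioc
  · have h : IntegrableOn (fun x : ℝ ↦ x ^ (-β)) (Ioi 1) :=
      integrableOn_Ioi_rpow_of_lt (by linarith [hβ.1]) one_pos
    exact h.congr_fun (fun x hx ↦ by simp [not_le.2 (mem_Ioi.1 hx)]) measurableSet_Ioi

lemma norm_exp_sub_one_add_linear_mul_rpow_le (β : ℝ) {s : ℂ} (hs : 0 ≤ s.re) {M : ℝ}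
    (hM : ‖s‖ ≤ M) (hM1 : 1 ≤ M) {x : ℝ} (hx : 0 < x) :
    ‖(Complex.exp (-s * x) - 1 + s * x) * ((x ^ (-1 - β) : ℝ) : ℂ)‖ ≤
      3 * M ^ 2 * (if x ≤ 1 then x ^ (1 - β) else x ^ (-β)) := by
  have hre : 0 ≤ (s * x).re := by simpa using mul_nonneg hs hx.le
  have hp : 0 ≤ x ^ (-1 - β) := Real.rpow_nonneg hx.le _
  have hnorm : ‖s * x‖ = ‖s‖ * x := by simp [abs_of_pos hx]
  rw [norm_mul, Complex.norm_of_nonneg hp, neg_mul]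
  split_ifs with h
  · have hxp : x ^ (1 - β) = x ^ 2 * x ^ (-1 - β) := by
      rw [← Real.rpow_natCast, ← Real.rpow_add hx]; congr 1; push_cast; ring
    rw [hxp, ← mul_assoc]
    refine mul_le_mul_of_nonneg_right ((norm_exp_neg_sub_one_add_le_sq hre).trans ?_) hp
    rw [hnorm, mul_pow, ← mul_assoc]
    gcongr
  · have hxp : x ^ (-β) = x * x ^ (-1 - β) := by
      nth_rewrite 2 [← Real.rpow_one x]
      rw [← Real.rpow_add hx]; congr 1; ring
    rw [hxp, ← mul_assoc]
    refine mul_le_mul_of_nonneg_right ((norm_exp_neg_sub_one_add_le hre).trans ?_) hp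
    rw [hnorm, ← mul_assoc]
    gcongr
    nlinarith

lemma aestronglyMeasurable_exp_sub_one_add_linear_mul_rpow (β : ℝ) (s : ℂ) (μ : Measure ℝ) :
    AEStronglyMeasurable
      (fun x : ℝ ↦ (Complex.exp (-s * x) - 1 + s * x) * ((x ^ (-1 - β) : ℝ) : ℂ)) μ := by
  refine Measurable.aestronglyMeasurable ?_
  fun_prop

/-- The integral formula in the open half-plane `0 < Re s`. -/
lemma integral_exp_sub_one_add_linear_rpow_of_re_pos {β : ℝ} (hβ : β ∈ Ioo (1 : ℝ) 2) {s : ℂ}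
    (hs : 0 < s.re) :
    ∫ x in Ioi (0 : ℝ), (Complex.exp (-s * x) - 1 + s * x) * ((x ^ (-1 - β) : ℝ) : ℂ)
      = (Real.Gamma (-β) : ℂ) * s ^ (β : ℂ) := by
  obtain ⟨h1, h2⟩ := hβ
  have hs0 : s ≠ 0 := by rintro rfl; simp at hs
  have hβ0 : (β : ℂ) ≠ 0 := by exact_mod_cast (by linarith : β ≠ 0)
  have hβ1 : (β : ℂ) - 1 ≠ 0 := by exact_mod_cast (by linarith : β - 1 ≠ 0)
  set F : ℝ → ℂ := fun x ↦ (Complex.exp (-s * x) - 1 + s * x) * ((x ^ (-1 - β) : ℝ) : ℂ) with hF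
  set L : ℝ → ℂ := fun x ↦ Complex.exp (-s * x) * ((x ^ (2 - β - 1) : ℝ) : ℂ) with hL
  set c : ℂ := s ^ 2 / (β * (β - 1)) with hc
  have hFint : IntegrableOn F (Ioi 0) := by
    refine Integrable.mono' ((integrableOn_ite_rpow ⟨h1, h2⟩).const_mul (3 * (‖s‖ + 1) ^ 2))
      (aestronglyMeasurable_exp_sub_one_add_linear_mul_rpow β s _) ?_
    filter_upwards [ae_restrict_mem measurableSet_Ioi] with x hx
    exact norm_exp_sub_one_add_linear_mul_rpow_le β hs.le (by linarith)
      (by linarith [norm_nonneg s]) hx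
  have hLint : IntegrableOn L (Ioi 0) := by
    refine Integrable.mono' (integrableOn_exp_neg_mul_mul_rpow (a := 2 - β) (by linarith) hs)
      (Measurable.aestronglyMeasurable (by fun_prop)) ?_
    filter_upwards [ae_restrict_mem measurableSet_Ioi] with x hx
    have hp : 0 ≤ x ^ (2 - β - 1) := Real.rpow_nonneg (le_of_lt hx) _
    rw [hL, norm_mul, Complex.norm_of_nonneg hp, Complex.norm_exp]
    simp
  set H : ℝ → ℂ := fun x ↦
    -(1 / β) * ((Complex.exp (-s * x) - 1 + s * x) * ((x ^ (-β) : ℝ) : ℂ))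
      - s / (β * (β - 1)) * ((1 - Complex.exp (-s * x)) * ((x ^ (1 - β) : ℝ) : ℂ)) with hH
  have hderiv : ∀ x ∈ Ioi (0 : ℝ), HasDerivAt H (F x - c * L x) x := by
    intro x hx
    have hx' : x ≠ 0 := ne_of_gt hx
    have hlin : HasDerivAt (fun x : ℝ ↦ s * (x : ℂ)) s x := by
      simpa using (Complex.ofRealCLM.hasDerivAt (x := x)).const_mul s
    have hexp : HasDerivAt (fun x : ℝ ↦ Complex.exp (-s * x))
        (Complex.exp (-s * x) * -s) x := by
      simpa only [neg_mul] using! hlin.neg.cexp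
    have hr1 := (Real.hasDerivAt_rpow_const (p := -β) (Or.inl hx')).ofReal_comp
    have hr2 := (Real.hasDerivAt_rpow_const (p := 1 - β) (Or.inl hx')).ofReal_comp
    have := ((((hexp.sub_const 1).add hlin).mul hr1).const_mul (-(1 / β : ℂ))).sub
      (((hexp.const_sub 1).mul hr2).const_mul (s / (β * (β - 1))))
    convert! this using 1
    have e1 : -β - 1 = -1 - β := by ring
    have e2 : 1 - β - 1 = -β := by ring
    have e3 : 2 - β - 1 = 1 - β := by ring
    simp only [hF, hL, hc, e1, e2, e3, Pi.add_apply]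
    push_cast
    field_simp
    ring
  have hnorm {x : ℝ} (hx : 0 < x) : ‖s * x‖ = ‖s‖ * x := by simp [abs_of_pos hx]
  have hre {x : ℝ} (hx : 0 < x) : 0 ≤ (s * x).re := by simpa using mul_nonneg hs.le hx.le
  have hbound (x A B : ℝ) (hx : 0 < x) (hA : ‖Complex.exp (-(s * x)) - 1 + s * x‖ ≤ A)
      (hB : ‖1 - Complex.exp (-(s * x))‖ ≤ B) : ‖H x‖ ≤ ‖-(1 / β : ℂ)‖ * (A * x ^ (-β)) +
        ‖s / (β * (β - 1))‖ * (B * x ^ (1 - β)) := by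
    refine (norm_sub_le _ _).trans ?_
    have hp1 : 0 ≤ x ^ (-β) := Real.rpow_nonneg hx.le _
    have hp2 : 0 ≤ x ^ (1 - β) := Real.rpow_nonneg hx.le _
    rw [norm_mul, norm_mul, norm_mul, norm_mul, Complex.norm_of_nonneg hp1,
      Complex.norm_of_nonneg hp2, neg_mul]
    gcongr
  have hx1 {x : ℝ} (hx : 0 < x) : x ^ (1 - β) = x * x ^ (-β) := by
    rw [sub_eq_add_neg, Real.rpow_add hx, Real.rpow_one]
  have hx2 {x : ℝ} (hx : 0 < x) : x ^ (2 - β) = x ^ 2 * x ^ (-β) := by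
    rw [sub_eq_add_neg, Real.rpow_add hx, Real.rpow_ofNat]
  have hzero : Tendsto H (𝓝[>] 0) (𝓝 0) := by
    have hlim : Tendsto (fun x : ℝ ↦ (‖-(1 / β : ℂ)‖ * (3 * ‖s‖ ^ 2) +
        ‖s / (β * (β - 1))‖ * (2 * ‖s‖)) * x ^ (2 - β)) (𝓝[>] 0) (𝓝 0) := by
      have : Tendsto (fun x : ℝ ↦ x ^ (2 - β)) (𝓝 0) (𝓝 0) := by
        have := Real.continuousAt_rpow_const 0 (2 - β) (Or.inr (by linarith))
        simpa [ContinuousAt, Real.zero_rpow (by linarith : 2 - β ≠ 0)] using this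
      simpa using (this.mono_left nhdsWithin_le_nhds).const_mul _
    refine squeeze_zero_norm' ?_ hlim
    filter_upwards [self_mem_nhdsWithin] with x hx
    refine (hbound x _ _ hx (norm_exp_neg_sub_one_add_le_sq (hre hx))
      (norm_one_sub_exp_neg_le (hre hx))).trans_eq ?_
    rw [hnorm hx, hx1 hx, hx2 hx]
    ring
  have hinfty : Tendsto H atTop (𝓝 0) := by
    have hlim : Tendsto (fun x : ℝ ↦ (‖-(1 / β : ℂ)‖ * (3 * ‖s‖) +
        ‖s / (β * (β - 1))‖ * 2) * x ^ (1 - β)) atTop (𝓝 0) := by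
      have := tendsto_rpow_neg_atTop (y := β - 1) (by linarith)
      simpa using this.const_mul (‖-(1 / β : ℂ)‖ * (3 * ‖s‖) + ‖s / (β * (β - 1))‖ * 2)
    refine squeeze_zero_norm' ?_ hlim
    filter_upwards [eventually_gt_atTop 0] with x hx
    refine (hbound x _ _ hx (norm_exp_neg_sub_one_add_le (hre hx))
      (norm_one_sub_exp_neg_le_two (hre hx))).trans_eq ?_
    rw [hnorm hx, hx1 hx]
    ring
  have hcont : ContinuousWithinAt H (Ici 0) 0 := by
    rw [← continuousWithinAt_Ioi_iff_Ici]
    have : H 0 = 0 := by simp [hH]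
    simpa [ContinuousWithinAt, this] using hzero
  have key := integral_Ioi_of_hasDerivAt_of_tendsto hcont hderiv
    (hFint.sub (hLint.const_mul c)) hinfty
  have hH0 : H 0 = 0 := by simp [hH]
  rw [integral_sub hFint (hLint.const_mul c), integral_const_mul, hH0, sub_zero, sub_eq_zero,
    integral_cexp_neg_mul_mul_rpow (by linarith) hs] at key
  have hG : Real.Gamma (2 - β) = (1 - β) * (-β * Real.Gamma (-β)) := by
    rw [← Real.Gamma_add_one (by linarith : -β ≠ 0), show -β + 1 = 1 - β by ring,
      ← Real.Gamma_add_one (by linarith : 1 - β ≠ 0)]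
    congr 1
    ring
  have hpow : s ^ (-((2 - β : ℝ) : ℂ)) = s ^ (β : ℂ) / s ^ 2 := by
    rw [show -((2 - β : ℝ) : ℂ) = (β : ℂ) - (2 : ℕ) by push_cast; ring, Complex.cpow_sub _ _ hs0,
      Complex.cpow_natCast]
  rw [key, hG, hpow, hc]
  push_cast
  field_simp
  ring

/-- For `β ∈ (1,2)` and `s ∈ ℂ` with `Re s ≥ 0`, `s ≠ 0`:
`∫₀^∞ (e^{-sx} − 1 + sx) x^{-1-β} dx = Γ(−β) s^β` (principal branch power). -/
theorem integral_exp_sub_one_add_linear_rpow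
    (β : ℝ) (hβ : β ∈ Set.Ioo (1:ℝ) 2) (s : ℂ) (hs : 0 ≤ s.re) (hs0 : s ≠ 0) :
    ∫ x in Set.Ioi (0:ℝ), (Complex.exp (-s * x) - 1 + s * x) * ((x ^ (-1 - β) : ℝ) : ℂ)
      = (Real.Gamma (-β) : ℂ) * s ^ (β : ℂ) := by
  have hleft : ContinuousWithinAt (fun z : ℂ ↦ ∫ x in Ioi (0 : ℝ),
      (Complex.exp (-z * x) - 1 + z * x) * ((x ^ (-1 - β) : ℝ) : ℂ)) {z | 0 ≤ z.re} s := by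
    refine continuousWithinAt_of_dominated
      (Eventually.of_forall fun z ↦ aestronglyMeasurable_exp_sub_one_add_linear_mul_rpow β z _) ?_
      ((integrableOn_ite_rpow hβ).const_mul (3 * (‖s‖ + 1) ^ 2)) ?_
    · have hball : ∀ᶠ z in 𝓝[{z : ℂ | 0 ≤ z.re}] s, ‖z‖ < ‖s‖ + 1 :=
        nhdsWithin_le_nhds (continuous_norm.continuousAt.eventually_lt continuousAt_const
          (by simp))
      filter_upwards [self_mem_nhdsWithin, hball] with z hz hzM
      filter_upwards [ae_restrict_mem measurableSet_Ioi] with x hx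
      exact norm_exp_sub_one_add_linear_mul_rpow_le β hz hzM.le
        (by linarith [norm_nonneg s]) hx
    · refine ae_of_all _ fun x ↦ Continuous.continuousWithinAt ?_
      fun_prop
  have hslit : s ∈ Complex.slitPlane := by
    rcases hs.eq_or_lt with h | h
    · exact Or.inr fun him ↦ hs0 (Complex.ext h.symm him)
    · exact Or.inl h
  have hright : ContinuousAt (fun z : ℂ ↦ (Real.Gamma (-β) : ℂ) * z ^ (β : ℂ)) s :=
    continuousAt_const.mul
      (differentiableAt_id.cpow_const hslit : DifferentiableAt ℂ (fun z : ℂ ↦ z ^ (β : ℂ)) s).continuousAt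
  have hshift : Tendsto (fun ε : ℝ ↦ s + ε) (𝓝[>] 0) (𝓝 s) :=
    (Continuous.tendsto' (by fun_prop) 0 s (by simp)).mono_left nhdsWithin_le_nhds
  have hshift' : Tendsto (fun ε : ℝ ↦ s + ε) (𝓝[>] 0) (𝓝[{z | 0 ≤ z.re}] s) := by
    refine tendsto_nhdsWithin_iff.2 ⟨hshift, ?_⟩
    filter_upwards [self_mem_nhdsWithin] with ε hε
    simpa using add_nonneg hs (le_of_lt hε)
  refine tendsto_nhds_unique_of_eventuallyEq (hleft.tendsto.comp hshift')
    (hright.tendsto.comp hshift) ?_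
  filter_upwards [self_mem_nhdsWithin] with ε hε
  exact integral_exp_sub_one_add_linear_rpow_of_re_pos hβ
    (by simpa using add_pos_of_nonneg_of_pos hs hε)
end

section
/- Let λ > 0, let β ∈ (0,1) ∪ (1,2), and let k ∈ ℝ. Then ∫₀^∞ (1 − cos(kx)) e^{-λx} x^{-1-β} dx = Γ(−β) · ( λ^β − ((λ + ik)^β + (λ − ik)^β)/2 ), where (λ ± ik)^β are principal-branch complex powers, λ^β is the real power, and Γ(−β) is the (real) Gamma function evaluated at −β; in particular the right-hand side is a real number. -/
open MeasureTheory

/-- The function `x ↦ x ^ a * exp (-λ x)` is integrable on `(0, ∞)` for `a > -1` and `λ > 0`. -/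
lemma integrableOn_rpow_mul_exp_neg_mul_Ioi {a lam : ℝ} (ha : -1 < a) (hlam : 0 < lam) :
    IntegrableOn (fun x : ℝ ↦ x ^ a * Real.exp (-lam * x)) (Set.Ioi 0) := by
  simpa using integrableOn_rpow_mul_exp_neg_mul_rpow ha one_pos hlam

lemma norm_cexp_neg_add_I_mul_mul (lam k x : ℝ) :
    ‖Complex.exp (-(lam + Complex.I * k) * x)‖ = Real.exp (-lam * x) := by
  simp [Complex.norm_exp]

lemma add_I_mul_mem_slitPlane {lam : ℝ} (hlam : 0 < lam) (k : ℝ) :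
    (lam + Complex.I * k : ℂ) ∈ Complex.slitPlane :=
  Or.inl (by simpa using hlam)

lemma continuousOn_rpow_Ioi (a : ℝ) : ContinuousOn (fun x : ℝ ↦ x ^ a) (Set.Ioi 0) :=
  fun x hx ↦ (Real.continuousAt_rpow_const x a (Or.inl (ne_of_gt hx))).continuousWithinAt

lemma integrableOn_rpow_mul_cexp_Ioi {a lam : ℝ} (ha : -1 < a) (hlam : 0 < lam) (k : ℝ) :
    IntegrableOn (fun x : ℝ ↦ ((x ^ a : ℝ) : ℂ) * Complex.exp (-(lam + Complex.I * k) * x))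
      (Set.Ioi 0) := by
  refine (integrableOn_rpow_mul_exp_neg_mul_Ioi ha hlam).mono' ?_ ?_
  · refine ContinuousOn.aestronglyMeasurable ?_ measurableSet_Ioi
    have := continuousOn_rpow_Ioi a
    fun_prop
  · filter_upwards [ae_restrict_mem measurableSet_Ioi] with x hx
    rw [norm_mul, norm_cexp_neg_add_I_mul_mul, Complex.norm_real, Real.norm_eq_abs,
      abs_of_nonneg (Real.rpow_nonneg (le_of_lt hx) a)]

/-- Integration by parts for the Laplace transform of a power. -/
lemma mul_integral_rpow_mul_cexp_Ioi {s lam : ℝ} (hs : 0 < s) (hlam : 0 < lam) (k : ℝ) :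
    (lam + Complex.I * k) *
        ∫ x in Set.Ioi (0 : ℝ), ((x ^ s : ℝ) : ℂ) * Complex.exp (-(lam + Complex.I * k) * x)
      = s * ∫ x in Set.Ioi (0 : ℝ),
          ((x ^ (s - 1) : ℝ) : ℂ) * Complex.exp (-(lam + Complex.I * k) * x) := by
  set z : ℂ := lam + Complex.I * k
  have hi1 := integrableOn_rpow_mul_cexp_Ioi (a := s - 1) (by linarith) hlam k
  have hi2 := integrableOn_rpow_mul_cexp_Ioi (a := s) (by linarith) hlam k
  have hderiv : ∀ x ∈ Set.Ioi (0 : ℝ),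
      HasDerivAt (fun x : ℝ ↦ ((x ^ s : ℝ) : ℂ) * Complex.exp (-z * x))
        (s * (((x ^ (s - 1) : ℝ) : ℂ) * Complex.exp (-z * x))
          - z * (((x ^ s : ℝ) : ℂ) * Complex.exp (-z * x))) x := by
    intro x hx
    have h1 := (Real.hasDerivAt_rpow_const (p := s) (Or.inl (ne_of_gt hx))).ofReal_comp
    have h2 : HasDerivAt (fun x : ℝ ↦ Complex.exp (-z * x)) (Complex.exp (-z * x) * (-z)) x := by
      simpa using ((hasDerivAt_id x).ofReal_comp.const_mul (-z)).cexp
    refine (h1.mul h2).congr_deriv ?_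
    push_cast
    ring
  have hcont : ContinuousWithinAt (fun x : ℝ ↦ ((x ^ s : ℝ) : ℂ) * Complex.exp (-z * x))
      (Set.Ici 0) 0 := by
    have := Real.continuous_rpow_const hs.le
    exact Continuous.continuousWithinAt (by fun_prop)
  have hlim : Filter.Tendsto (fun x : ℝ ↦ ((x ^ s : ℝ) : ℂ) * Complex.exp (-z * x))
      Filter.atTop (nhds 0) := by
    rw [tendsto_zero_iff_norm_tendsto_zero]
    refine (tendsto_rpow_mul_exp_neg_mul_atTop_nhds_zero s lam hlam).congr' ?_
    filter_upwards [Filter.eventually_ge_atTop 0] with x hx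
    rw [norm_mul, norm_cexp_neg_add_I_mul_mul, Complex.norm_real, Real.norm_eq_abs,
      abs_of_nonneg (Real.rpow_nonneg hx s)]
  have := integral_Ioi_of_hasDerivAt_of_tendsto hcont hderiv
    ((hi1.const_mul _).sub (hi2.const_mul _)) hlim
  rw [integral_sub (hi1.const_mul _) (hi2.const_mul _), integral_const_mul, integral_const_mul,
    Real.zero_rpow hs.ne', Complex.ofReal_zero, zero_mul] at this
  linear_combination -this

lemma hasDerivAt_integral_rpow_mul_cexp_Ioi {s lam : ℝ} (hs : 0 < s) (hlam : 0 < lam) (k : ℝ) :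
    HasDerivAt (fun k : ℝ ↦ ∫ x in Set.Ioi (0 : ℝ),
        ((x ^ (s - 1) : ℝ) : ℂ) * Complex.exp (-(lam + Complex.I * k) * x))
      (-Complex.I * ∫ x in Set.Ioi (0 : ℝ),
        ((x ^ s : ℝ) : ℂ) * Complex.exp (-(lam + Complex.I * k) * x)) k := by
  rw [← integral_const_mul]
  refine (hasDerivAt_integral_of_dominated_loc_of_deriv_le
    (F' := fun k x ↦ -Complex.I * (((x ^ s : ℝ) : ℂ) *
      Complex.exp (-(lam + Complex.I * k) * x)))
    (bound := fun x ↦ x ^ s * Real.exp (-lam * x)) Filter.univ_mem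
    (Filter.Eventually.of_forall fun k ↦
      (integrableOn_rpow_mul_cexp_Ioi (by linarith) hlam k).aestronglyMeasurable)
    (integrableOn_rpow_mul_cexp_Ioi (by linarith) hlam k)
    ((integrableOn_rpow_mul_cexp_Ioi (by linarith) hlam k).const_mul _).aestronglyMeasurable
    ?_ (integrableOn_rpow_mul_exp_neg_mul_Ioi (by linarith) hlam) ?_).2
  · filter_upwards [ae_restrict_mem measurableSet_Ioi] with x hx k _
    rw [norm_mul, norm_mul, norm_cexp_neg_add_I_mul_mul, Complex.norm_real, Real.norm_eq_abs,
      abs_of_nonneg (Real.rpow_nonneg (le_of_lt hx) s)]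
    simp
  · filter_upwards [ae_restrict_mem measurableSet_Ioi] with x hx k _
    have h : HasDerivAt (fun k : ℝ ↦ -(lam + Complex.I * k) * x) (-Complex.I * x) k := by
      simpa using
        (((hasDerivAt_id k).ofReal_comp.const_mul Complex.I).const_add (lam : ℂ)).neg.mul_const
          (x : ℂ)
    refine (h.cexp.const_mul _).congr_deriv ?_
    have hxs : x ^ s = x ^ (s - 1) * x := by
      rw [← Real.rpow_add_one (ne_of_gt hx), sub_add_cancel]
    rw [hxs]
    push_cast
    ring

lemma hasDerivAt_add_I_mul_cpow {lam : ℝ} (hlam : 0 < lam) (c : ℂ) (k : ℝ) :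
    HasDerivAt (fun k : ℝ ↦ (lam + Complex.I * k : ℂ) ^ c)
      (c * (lam + Complex.I * k) ^ (c - 1) * Complex.I) k := by
  have h : HasDerivAt (fun k : ℝ ↦ (lam + Complex.I * k : ℂ)) Complex.I k := by
    simpa using ((hasDerivAt_id k).ofReal_comp.const_mul Complex.I).const_add (lam : ℂ)
  refine ((Complex.hasStrictDerivAt_cpow_const
    (add_I_mul_mem_slitPlane hlam k)).hasDerivAt.scomp k h).congr_deriv ?_
  rw [smul_eq_mul, mul_comm]

lemma hasDerivAt_sub_I_mul_cpow {lam : ℝ} (hlam : 0 < lam) (c : ℂ) (k : ℝ) :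
    HasDerivAt (fun k : ℝ ↦ (lam - Complex.I * k : ℂ) ^ c)
      (-(c * (lam - Complex.I * k) ^ (c - 1) * Complex.I)) k := by
  have h := (hasDerivAt_add_I_mul_cpow hlam c (-k)).scomp k (hasDerivAt_neg k)
  simpa [Function.comp_def, sub_eq_add_neg] using h

/-- The Laplace transform of a power on the right half-plane. -/
lemma integral_rpow_mul_cexp_Ioi {s lam : ℝ} (hs : 0 < s) (hlam : 0 < lam) (k : ℝ) :
    ∫ x in Set.Ioi (0 : ℝ),
        ((x ^ (s - 1) : ℝ) : ℂ) * Complex.exp (-(lam + Complex.I * k) * x)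
      = Real.Gamma s * (lam + Complex.I * k) ^ (-s : ℂ) := by
  set J : ℝ → ℂ := fun k ↦ ∫ x in Set.Ioi (0 : ℝ),
    ((x ^ (s - 1) : ℝ) : ℂ) * Complex.exp (-(lam + Complex.I * k) * x) with hJ
  have hne (k : ℝ) : (lam + Complex.I * k : ℂ) ≠ 0 :=
    Complex.slitPlane_ne_zero (add_I_mul_mem_slitPlane hlam k)
  have hder (k : ℝ) : HasDerivAt (fun k ↦ J k * (lam + Complex.I * k : ℂ) ^ (s : ℂ)) 0 k := by
    refine ((hasDerivAt_integral_rpow_mul_cexp_Ioi hs hlam k).mul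
      (hasDerivAt_add_I_mul_cpow hlam s k)).congr_deriv ?_
    have h := mul_integral_rpow_mul_cexp_Ioi hs hlam k
    rw [Complex.cpow_sub _ _ (hne k), Complex.cpow_one]
    have hz := hne k
    generalize (∫ x in Set.Ioi (0 : ℝ),
      ((x ^ s : ℝ) : ℂ) * Complex.exp (-(lam + Complex.I * k) * x)) = A at h ⊢
    generalize (∫ x in Set.Ioi (0 : ℝ),
      ((x ^ (s - 1) : ℝ) : ℂ) * Complex.exp (-(lam + Complex.I * k) * x)) = B at h ⊢
    field_simp
    linear_combination -Complex.I * (lam + Complex.I * k : ℂ) ^ (s : ℂ) * h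
  have hconst := is_const_of_deriv_eq_zero (fun k ↦ (hder k).differentiableAt)
    (fun k ↦ (hder k).deriv) k 0
  have h0 : J 0 = Real.Gamma s * (lam : ℂ) ^ (-s : ℂ) := by
    have h := congrArg (fun r : ℝ ↦ (r : ℂ)) (Real.integral_rpow_mul_exp_neg_mul_Ioi hs hlam)
    simp only [← integral_complex_ofReal] at h
    rw [one_div, Real.inv_rpow hlam.le, ← Real.rpow_neg hlam.le, Complex.ofReal_mul,
      Complex.ofReal_cpow hlam.le, mul_comm (_ ^ _)] at h
    simpa [hJ] using h
  have hlam' : (lam : ℂ) ≠ 0 := by exact_mod_cast hlam.ne'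
  simp only [h0, Complex.ofReal_zero, mul_zero, add_zero, mul_assoc] at hconst
  rw [← Complex.cpow_add _ _ hlam', neg_add_cancel, Complex.cpow_zero, mul_one] at hconst
  rw [← hconst, mul_assoc, ← Complex.cpow_add _ _ (hne k), add_neg_cancel, Complex.cpow_zero,
    mul_one]

lemma integral_cos_mul_exp_mul_rpow_Ioi {s lam : ℝ} (hs : 0 < s) (hlam : 0 < lam) (k : ℝ) :
    ((∫ x in Set.Ioi (0 : ℝ), Real.cos (k * x) * Real.exp (-lam * x) * x ^ (s - 1) : ℝ) : ℂ)
      = Real.Gamma s *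
        (((lam + Complex.I * k) ^ (-s : ℂ) + (lam - Complex.I * k) ^ (-s : ℂ)) / 2) := by
  have h1 := integral_rpow_mul_cexp_Ioi hs hlam k
  have h2 := integral_rpow_mul_cexp_Ioi hs hlam (-k)
  have hi1 := integrableOn_rpow_mul_cexp_Ioi (a := s - 1) (by linarith) hlam k
  have hi2 := integrableOn_rpow_mul_cexp_Ioi (a := s - 1) (by linarith) hlam (-k)
  have hsub : (lam + Complex.I * (-k : ℝ) : ℂ) = lam - Complex.I * k := by push_cast; ring
  rw [hsub] at h2 hi2
  rw [mul_div_assoc', mul_add, ← h1, ← h2, ← integral_add hi1 hi2, ← integral_div,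
    ← integral_complex_ofReal]
  congr 1 with x
  have e1 : -(lam + Complex.I * k : ℂ) * x = -lam * x + -(k * x) * Complex.I := by ring
  have e2 : -(lam - Complex.I * k : ℂ) * x = -lam * x + k * x * Complex.I := by ring
  push_cast
  rw [e1, e2, Complex.exp_add, Complex.exp_add, Complex.cos]
  ring

lemma hasDerivAt_integral_sin_mul_exp_mul_rpow {β lam : ℝ} (hβ : β < 2) (hlam : 0 < lam) (k : ℝ) :
    IntegrableOn (fun x : ℝ ↦ Real.sin (k * x) * Real.exp (-lam * x) * x ^ (-β)) (Set.Ioi 0) ∧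
    HasDerivAt (fun k : ℝ ↦ ∫ x in Set.Ioi (0 : ℝ),
        Real.sin (k * x) * Real.exp (-lam * x) * x ^ (-β))
      (∫ x in Set.Ioi (0 : ℝ), Real.cos (k * x) * Real.exp (-lam * x) * x ^ (1 - β)) k := by
  have hdom := integrableOn_rpow_mul_exp_neg_mul_Ioi (a := 1 - β) (by linarith) hlam
  have hmeas (k : ℝ) : AEStronglyMeasurable
      (fun x : ℝ ↦ Real.sin (k * x) * Real.exp (-lam * x) * x ^ (-β))
      (volume.restrict (Set.Ioi 0)) := by
    refine ContinuousOn.aestronglyMeasurable ?_ measurableSet_Ioi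
    have := continuousOn_rpow_Ioi (-β)
    fun_prop
  have hpow {x : ℝ} (hx : x ∈ Set.Ioi 0) : x ^ (1 - β) = x * x ^ (-β) := by
    rw [sub_eq_add_neg, Real.rpow_add hx, Real.rpow_one]
  have hint : IntegrableOn (fun x : ℝ ↦ Real.sin (k * x) * Real.exp (-lam * x) * x ^ (-β))
      (Set.Ioi 0) := by
    refine (hdom.const_mul |k|).mono' (hmeas k) ?_
    filter_upwards [ae_restrict_mem measurableSet_Ioi] with x hx
    have h1 : |Real.sin (k * x)| ≤ |k| * x := by
      simpa [abs_mul, abs_of_pos (Set.mem_Ioi.1 hx)] using Real.abs_sin_le_abs (x := k * x)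
    have h2 : 0 ≤ Real.exp (-lam * x) * x ^ (-β) :=
      mul_nonneg (Real.exp_pos _).le (Real.rpow_nonneg (le_of_lt hx) _)
    rw [mul_assoc, Real.norm_eq_abs, abs_mul, abs_of_nonneg h2, hpow hx]
    calc _ ≤ |k| * x * (Real.exp (-lam * x) * x ^ (-β)) := by gcongr
      _ = _ := by ring
  refine ⟨hint, (hasDerivAt_integral_of_dominated_loc_of_deriv_le
    (F' := fun k x ↦ Real.cos (k * x) * Real.exp (-lam * x) * x ^ (1 - β))
    Filter.univ_mem (Filter.Eventually.of_forall hmeas) hint ?_ ?_ hdom ?_).2⟩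
  · refine ContinuousOn.aestronglyMeasurable ?_ measurableSet_Ioi
    have := continuousOn_rpow_Ioi (1 - β)
    fun_prop
  · filter_upwards [ae_restrict_mem measurableSet_Ioi] with x hx k _
    have h2 : 0 ≤ Real.exp (-lam * x) * x ^ (1 - β) :=
      mul_nonneg (Real.exp_pos _).le (Real.rpow_nonneg (le_of_lt hx) _)
    rw [mul_assoc, Real.norm_eq_abs, abs_mul, abs_of_nonneg h2, mul_comm (x ^ _)]
    exact mul_le_of_le_one_left h2 (Real.abs_cos_le_one _)
  · filter_upwards [ae_restrict_mem measurableSet_Ioi] with x hx k _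
    refine ((((hasDerivAt_id k).mul_const x).sin.mul_const (Real.exp (-lam * x))).mul_const
      (x ^ (-β))).congr_deriv ?_
    rw [hpow hx]
    simp only [id]
    ring

lemma hasDerivAt_integral_one_sub_cos_mul_exp_mul_rpow {β lam : ℝ} (hβ : β < 2) (hlam : 0 < lam)
    (k : ℝ) :
    HasDerivAt (fun k : ℝ ↦ ∫ x in Set.Ioi (0 : ℝ),
        (1 - Real.cos (k * x)) * Real.exp (-lam * x) * x ^ (-1 - β))
      (∫ x in Set.Ioi (0 : ℝ), Real.sin (k * x) * Real.exp (-lam * x) * x ^ (-β)) k := by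
  have hdom := integrableOn_rpow_mul_exp_neg_mul_Ioi (a := 1 - β) (by linarith) hlam
  have hmeas (k : ℝ) : AEStronglyMeasurable
      (fun x : ℝ ↦ (1 - Real.cos (k * x)) * Real.exp (-lam * x) * x ^ (-1 - β))
      (volume.restrict (Set.Ioi 0)) := by
    refine ContinuousOn.aestronglyMeasurable ?_ measurableSet_Ioi
    have := continuousOn_rpow_Ioi (-1 - β)
    fun_prop
  have hpow {x : ℝ} (hx : x ∈ Set.Ioi 0) : x ^ (-β) = x * x ^ (-1 - β) := by
    rw [show -β = 1 + (-1 - β) by ring, Real.rpow_add hx, Real.rpow_one]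
  have hpow' {x : ℝ} (hx : x ∈ Set.Ioi 0) : x ^ (1 - β) = x * x ^ (-β) := by
    rw [sub_eq_add_neg, Real.rpow_add hx, Real.rpow_one]
  have hint : IntegrableOn
      (fun x : ℝ ↦ (1 - Real.cos (k * x)) * Real.exp (-lam * x) * x ^ (-1 - β)) (Set.Ioi 0) := by
    refine (hdom.const_mul (k ^ 2 / 2)).mono' (hmeas k) ?_
    filter_upwards [ae_restrict_mem measurableSet_Ioi] with x hx
    have h0 : 0 ≤ 1 - Real.cos (k * x) := by linarith [Real.cos_le_one (k * x)]
    have h1 : 1 - Real.cos (k * x) ≤ k ^ 2 / 2 * x ^ 2 := by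
      linarith [Real.one_sub_sq_div_two_le_cos (x := k * x), mul_pow k x 2]
    have h2 : 0 ≤ Real.exp (-lam * x) * x ^ (-1 - β) :=
      mul_nonneg (Real.exp_pos _).le (Real.rpow_nonneg (le_of_lt hx) _)
    rw [mul_assoc, Real.norm_eq_abs, abs_of_nonneg (mul_nonneg h0 h2), hpow' hx, hpow hx]
    calc _ ≤ k ^ 2 / 2 * x ^ 2 * (Real.exp (-lam * x) * x ^ (-1 - β)) := by gcongr
      _ = _ := by ring
  refine (hasDerivAt_integral_of_dominated_loc_of_deriv_le
    (F' := fun k x ↦ Real.sin (k * x) * Real.exp (-lam * x) * x ^ (-β))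
    (bound := fun x ↦ (|k| + 1) * (x ^ (1 - β) * Real.exp (-lam * x)))
    (Metric.ball_mem_nhds k one_pos) (Filter.Eventually.of_forall hmeas) hint
    (hasDerivAt_integral_sin_mul_exp_mul_rpow hβ hlam k).1.aestronglyMeasurable ?_
    (hdom.const_mul _) ?_).2
  · filter_upwards [ae_restrict_mem measurableSet_Ioi] with x hx l hl
    have hx0 : 0 < x := hx
    have hlk : |l| ≤ |k| + 1 := by
      have h1 : |l - k| < 1 := by simpa [Real.dist_eq] using hl
      linarith [abs_sub_abs_le_abs_sub l k]
    have h1 : |Real.sin (l * x)| ≤ |l| * x := by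
      simpa [abs_mul, abs_of_pos hx0] using Real.abs_sin_le_abs (x := l * x)
    have h2 : 0 ≤ Real.exp (-lam * x) * x ^ (-β) :=
      mul_nonneg (Real.exp_pos _).le (Real.rpow_nonneg (le_of_lt hx) _)
    rw [mul_assoc, Real.norm_eq_abs, abs_mul, abs_of_nonneg h2, hpow' hx]
    calc _ ≤ (|k| + 1) * x * (Real.exp (-lam * x) * x ^ (-β)) := by
          refine mul_le_mul_of_nonneg_right (h1.trans ?_) h2
          gcongr
      _ = _ := by ring
  · filter_upwards [ae_restrict_mem measurableSet_Ioi] with x hx k _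
    refine (((((hasDerivAt_id k).mul_const x).cos.const_sub 1).mul_const
      (Real.exp (-lam * x))).mul_const (x ^ (-1 - β))).congr_deriv ?_
    rw [hpow hx]
    simp only [id]
    ring

lemma eq_of_hasDerivAt_eq {f g f' : ℝ → ℂ} (hf : ∀ x, HasDerivAt f (f' x) x)
    (hg : ∀ x, HasDerivAt g (f' x) x) (h0 : f 0 = g 0) : f = g :=
  eq_of_fderiv_eq (fun x ↦ (hf x).differentiableAt) (fun x ↦ (hg x).differentiableAt)
    (fun x ↦ by rw [(hf x).hasFDerivAt.fderiv, (hg x).hasFDerivAt.fderiv]) 0 h0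

/-- Fourier symbol of the one-dimensional tempered fractional operator:
`∫₀^∞ (1 − cos(kx)) e^{-λx} x^{-1-β} dx = Γ(−β)(λ^β − ((λ+ik)^β + (λ−ik)^β)/2)`,
the right-hand side being in particular real. -/
theorem integral_one_sub_cos_tempered_kernel
    (lam β k : ℝ) (hlam : 0 < lam)
    (hβ : β ∈ Set.Ioo (0:ℝ) 1 ∪ Set.Ioo (1:ℝ) 2) :
    ((∫ x in Set.Ioi (0:ℝ),
        (1 - Real.cos (k * x)) * Real.exp (-lam * x) * x ^ (-1 - β) : ℝ) : ℂ)
      = (Real.Gamma (-β) : ℂ) *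
          ((lam ^ β : ℝ) -
            (((lam : ℂ) + Complex.I * k) ^ (β : ℂ)
              + ((lam : ℂ) - Complex.I * k) ^ (β : ℂ)) / 2) := by
  have hβ0 : β ≠ 0 := by rintro rfl; norm_num at hβ
  have hβ1 : β ≠ 1 := by rintro rfl; simp at hβ
  have hβ2 : β < 2 := by rcases hβ with h | h <;> linarith [h.2]
  have hΓ : (Real.Gamma (2 - β) : ℂ) = (1 - β) * (-β * Real.Gamma (-β)) := by
    have h1 := Real.Gamma_add_one (s := 1 - β) (sub_ne_zero.2 hβ1.symm)
    have h2 := Real.Gamma_add_one (s := -β) (neg_ne_zero.2 hβ0)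
    rw [show -β + 1 = 1 - β by ring] at h2
    rw [h2, show 1 - β + 1 = 2 - β by ring] at h1
    rw [h1]
    push_cast
    ring
  have hcos (k : ℝ) :
      ((∫ x in Set.Ioi (0 : ℝ), Real.cos (k * x) * Real.exp (-lam * x) * x ^ (1 - β) : ℝ) : ℂ)
        = Real.Gamma (2 - β) * (((lam + Complex.I * k) ^ (β - 1 - 1 : ℂ)
          + (lam - Complex.I * k) ^ (β - 1 - 1 : ℂ)) / 2) := by
    have h := integral_cos_mul_exp_mul_rpow_Ioi (s := 2 - β) (by linarith) hlam k
    rw [show 2 - β - 1 = 1 - β by ring] at h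
    rw [h]
    push_cast
    ring_nf
  have hsin := eq_of_hasDerivAt_eq
    (fun k ↦ (hasDerivAt_integral_sin_mul_exp_mul_rpow hβ2 hlam k).2.ofReal_comp)
    (g := fun k : ℝ ↦ Real.Gamma (-β) * (-(β * Complex.I *
      ((lam + Complex.I * k) ^ (β - 1 : ℂ) - (lam - Complex.I * k) ^ (β - 1 : ℂ))) / 2))
    (fun k ↦ by
      refine (((((hasDerivAt_add_I_mul_cpow hlam (β - 1) k).sub
        (hasDerivAt_sub_I_mul_cpow hlam (β - 1) k)).const_mul (β * Complex.I)).neg.div_const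
          2).const_mul (Real.Gamma (-β) : ℂ)).congr_deriv ?_
      rw [hcos, hΓ]
      linear_combination (-(Real.Gamma (-β) : ℂ) * β * (β - 1) / 2 *
        ((lam + Complex.I * k) ^ (β - 1 - 1 : ℂ) + (lam - Complex.I * k) ^ (β - 1 - 1 : ℂ))) *
        Complex.I_sq)
    (by simp)
  refine congrFun (eq_of_hasDerivAt_eq
    (fun k ↦ (hasDerivAt_integral_one_sub_cos_mul_exp_mul_rpow hβ2 hlam k).ofReal_comp)
    (g := fun k : ℝ ↦ Real.Gamma (-β) * ((lam ^ β : ℝ) -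
      ((lam + Complex.I * k) ^ (β : ℂ) + (lam - Complex.I * k) ^ (β : ℂ)) / 2))
    (fun k ↦ ?_) ?_) k
  · refine (((((hasDerivAt_add_I_mul_cpow hlam β k).add
      (hasDerivAt_sub_I_mul_cpow hlam β k)).div_const 2).const_sub
        ((lam ^ β : ℝ) : ℂ)).const_mul (Real.Gamma (-β) : ℂ)).congr_deriv ?_
    refine Eq.trans ?_ (congrFun hsin k).symm
    ring
  · simp [Complex.ofReal_cpow hlam.le]
end

section
/- Let n ≥ 1 be an integer, let β ∈ (0,2), and set c_{n,β} = β Γ((n+β)/2) / (2^{1-β} π^{n/2} Γ(1 − β/2)). Then for every k ∈ ℝⁿ, c_{n,β} · ∫_{ℝⁿ} (1 − cos(⟨k, y⟩)) |y|^{-n-β} dy = |k|^β. -/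
open MeasureTheory
open scoped RealInnerProductSpace

lemma lintegral_ofReal_eq_of_integral_eq {α : Type*} [MeasurableSpace α] {μ : Measure α}
    {f : α → ℝ} {c : ℝ} (hf : 0 ≤ᵐ[μ] f) (h : ∫ x, f x ∂μ = c) (hc : c ≠ 0) :
    ∫⁻ x, ENNReal.ofReal (f x) ∂μ = ENNReal.ofReal c := by
  rw [← h, ofReal_integral_eq_lintegral_ofReal (.of_integral_ne_zero (by rwa [h])) hf]

lemma integral_rpow_mul_exp_neg_div_Ioi {b r : ℝ} (hb : b < 1) (hr : 0 < r) :
    ∫ t : ℝ in Set.Ioi 0, t ^ (b - 2) * Real.exp (-(r / t)) =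
      r ^ (b - 1) * Real.Gamma (1 - b) := by
  have h := Real.integral_rpow_mul_exp_neg_mul_Ioi (a := 1 - b) (by linarith) hr
  rw [← integral_comp_rpow_Ioi _ (p := -1) (by norm_num), one_div, Real.inv_rpow hr.le,
    ← Real.rpow_neg hr.le, neg_sub] at h
  rw [← h]
  refine setIntegral_congr_fun measurableSet_Ioi fun t (ht : 0 < t) ↦ ?_
  simp only [smul_eq_mul, abs_neg, abs_one, one_mul]
  rw [← Real.rpow_mul ht.le, ← mul_assoc, ← Real.rpow_add ht, Real.rpow_neg_one, div_eq_mul_inv]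
  ring_nf

lemma integral_one_sub_cos_mul_exp_neg_mul_sq_norm {V : Type*} [NormedAddCommGroup V]
    [InnerProductSpace ℝ V] [FiniteDimensional ℝ V] [MeasurableSpace V] [BorelSpace V]
    {t : ℝ} (ht : 0 < t) (k : V) :
    ∫ y : V, (1 - Real.cos ⟪k, y⟫) * Real.exp (-t * ‖y‖ ^ 2) =
      (Real.pi / t) ^ (Module.finrank ℝ V / 2 : ℝ) * (1 - Real.exp (-(‖k‖ ^ 2 / 4 / t))) := by
  have h1 := GaussianFourier.integral_rexp_neg_mul_sq_norm (V := V) ht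
  have i1 : Integrable fun y : V ↦ Real.exp (-t * ‖y‖ ^ 2) :=
    .of_integral_ne_zero (by rw [h1]; positivity)
  have h2 := GaussianFourier.integral_cexp_neg_mul_sq_norm_add (V := V) (b := t)
    (by simpa using ht) Complex.I k
  have hre (y : V) : (Complex.exp (-t * ‖y‖ ^ 2 + Complex.I * ⟪k, y⟫)).re =
      Real.cos ⟪k, y⟫ * Real.exp (-t * ‖y‖ ^ 2) := by
    rw [Complex.exp_re]
    simp [← Complex.ofReal_pow, mul_comm]
  have hval : ((Real.pi / t : ℂ) ^ (Module.finrank ℝ V / 2 : ℂ) *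
      Complex.exp (Complex.I ^ 2 * ‖k‖ ^ 2 / (4 * t))) =
      (((Real.pi / t) ^ (Module.finrank ℝ V / 2 : ℝ) * Real.exp (-(‖k‖ ^ 2 / 4 / t)) : ℝ) : ℂ) := by
    rw [Complex.ofReal_mul, Complex.ofReal_cpow (by positivity)]
    push_cast
    rw [Complex.I_sq]
    congr 2
    field_simp
  rw [hval] at h2
  have i2 := Integrable.of_integral_ne_zero (by
    rw [h2]; exact Complex.ofReal_ne_zero.2 (by positivity))
  have h3 := congrArg Complex.re h2
  have h4 := integral_re i2
  simp only [RCLike.re_eq_complex_re] at h4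
  rw [← h4, Complex.ofReal_re] at h3
  have i3 := i2.re
  simp only [RCLike.re_eq_complex_re, hre] at i3 h3
  simp only [sub_mul, one_mul]
  rw [integral_sub i1 i3, h1, h3]
  ring

lemma integral_inv_mul_exp_neg_div {a : ℝ} (ha : 0 < a) (t : ℝ) :
    ∫ r in Set.Ioc 0 a, t⁻¹ * Real.exp (-(r / t)) = 1 - Real.exp (-(a / t)) := by
  rw [← intervalIntegral.integral_of_le ha.le,
    intervalIntegral.integral_eq_sub_of_hasDerivAt (f := fun r ↦ -Real.exp (-(r / t)))]
  · simp
    ring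
  · intro r _
    convert! (((hasDerivAt_id r).div_const t).neg.exp).neg using 1
    simp
    ring
  · exact (by fun_prop : Continuous fun r : ℝ ↦ t⁻¹ * Real.exp (-(r / t))).intervalIntegrable _ _

lemma lintegral_rpow_mul_one_sub_exp_neg_div {a b : ℝ} (ha : 0 < a) (hb : 0 < b) (hb1 : b < 1) :
    ∫⁻ t in Set.Ioi (0 : ℝ), ENNReal.ofReal (t ^ (b - 1) * (1 - Real.exp (-(a / t)))) =
      ENNReal.ofReal (Real.Gamma (1 - b) * (a ^ b / b)) := by
  have hG : 0 < Real.Gamma (1 - b) := Real.Gamma_pos_of_pos (by linarith)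
  calc _ = ∫⁻ t in Set.Ioi (0 : ℝ), ∫⁻ r in Set.Ioc 0 a,
        ENNReal.ofReal (t ^ (b - 2) * Real.exp (-(r / t))) := by
        refine setLIntegral_congr_fun measurableSet_Ioi fun t (ht : 0 < t) ↦ ?_
        have h1 : 0 < 1 - Real.exp (-(a / t)) := by
          rw [sub_pos, Real.exp_lt_one_iff]
          have := div_pos ha ht
          linarith
        refine (lintegral_ofReal_eq_of_integral_eq (.of_forall fun r ↦ ?_) ?_ ?_).symm
        · simp only [Pi.zero_apply]; positivity
        · rw [← integral_inv_mul_exp_neg_div ha t, ← integral_const_mul]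
          congr 1 with r
          rw [← mul_assoc, ← Real.rpow_neg_one t, ← Real.rpow_add ht]
          ring_nf
        · positivity
    _ = ∫⁻ r in Set.Ioc 0 a, ∫⁻ t in Set.Ioi (0 : ℝ),
        ENNReal.ofReal (t ^ (b - 2) * Real.exp (-(r / t))) :=
        lintegral_lintegral_swap (by unfold Function.uncurry; fun_prop)
    _ = ∫⁻ r in Set.Ioc 0 a, ENNReal.ofReal (r ^ (b - 1) * Real.Gamma (1 - b)) := by
        refine setLIntegral_congr_fun measurableSet_Ioc fun r hr ↦ ?_
        have hr : 0 < r := hr.1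
        refine lintegral_ofReal_eq_of_integral_eq ?_
          (integral_rpow_mul_exp_neg_div_Ioi hb1 hr) (by positivity)
        filter_upwards [ae_restrict_mem measurableSet_Ioi] with t (ht : 0 < t)
        simp only [Pi.zero_apply]; positivity
    _ = _ := by
        refine lintegral_ofReal_eq_of_integral_eq ?_ ?_ (by positivity)
        · filter_upwards [ae_restrict_mem measurableSet_Ioc] with r hr
          have hr : 0 < r := hr.1
          simp only [Pi.zero_apply]; positivity
        · rw [integral_mul_const, ← intervalIntegral.integral_of_le ha.le,
            integral_rpow (.inl (by linarith)), sub_add_cancel, Real.zero_rpow hb.ne', sub_zero,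
            mul_comm]

lemma ofReal_Gamma_mul_lintegral_one_sub_cos_mul_norm_rpow {V : Type*} [NormedAddCommGroup V]
    [InnerProductSpace ℝ V] [FiniteDimensional ℝ V] [MeasurableSpace V] [BorelSpace V]
    {β : ℝ} (hβ : β ∈ Set.Ioo (0 : ℝ) 2) {k : V} (hk : k ≠ 0) :
    ENNReal.ofReal (Real.Gamma ((Module.finrank ℝ V + β) / 2)) *
      ∫⁻ y : V, ENNReal.ofReal ((1 - Real.cos ⟪k, y⟫) * ‖y‖ ^ (-(Module.finrank ℝ V : ℝ) - β)) =
    ENNReal.ofReal (Real.pi ^ (Module.finrank ℝ V / 2 : ℝ) *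
      (Real.Gamma (1 - β / 2) * ((‖k‖ ^ 2 / 4) ^ (β / 2) / (β / 2)))) := by
  obtain ⟨hβ0, hβ2⟩ := hβ
  set d : ℝ := (Module.finrank ℝ V : ℝ)
  have hd : 0 ≤ d := Nat.cast_nonneg _
  have hs : 0 < (d + β) / 2 := by linarith
  have hG := Real.Gamma_pos_of_pos hs
  have hk' : 0 < ‖k‖ := norm_pos_iff.2 hk
  have hcos (x : ℝ) : 0 ≤ 1 - Real.cos x := sub_nonneg.2 (Real.cos_le_one x)
  calc _ = ∫⁻ y : V, ∫⁻ t in Set.Ioi (0 : ℝ), ENNReal.ofReal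
        ((1 - Real.cos ⟪k, y⟫) * (t ^ ((d + β) / 2 - 1) * Real.exp (-(‖y‖ ^ 2 * t)))) := by
        rw [← lintegral_const_mul _ (by fun_prop)]
        congr 1 with y
        rcases eq_or_ne y 0 with rfl | hy
        · simp
        have hy' : 0 < ‖y‖ := norm_pos_iff.2 hy
        simp only [ENNReal.ofReal_mul (hcos _)]
        rw [lintegral_const_mul _ (by fun_prop), lintegral_ofReal_eq_of_integral_eq _
          (Real.integral_rpow_mul_exp_neg_mul_Ioi hs (by positivity)) (by positivity)]
        · rw [mul_left_comm, ← ENNReal.ofReal_mul hG.le, one_div, Real.inv_rpow (by positivity),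
            ← Real.rpow_natCast, ← Real.rpow_mul hy'.le, ← Real.rpow_neg hy'.le,
            mul_comm (Real.Gamma _)]
          congr 4
          push_cast; ring
        · filter_upwards [ae_restrict_mem measurableSet_Ioi] with t (ht : 0 < t)
          simp only [Pi.zero_apply]; positivity
    _ = ∫⁻ t in Set.Ioi (0 : ℝ), ∫⁻ y : V, ENNReal.ofReal
        ((1 - Real.cos ⟪k, y⟫) * (t ^ ((d + β) / 2 - 1) * Real.exp (-(‖y‖ ^ 2 * t)))) :=
        lintegral_lintegral_swap (by unfold Function.uncurry; fun_prop)
    _ = ∫⁻ t in Set.Ioi (0 : ℝ), ENNReal.ofReal (Real.pi ^ (d / 2)) *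
        ENNReal.ofReal (t ^ (β / 2 - 1) * (1 - Real.exp (-(‖k‖ ^ 2 / 4 / t)))) := by
        refine setLIntegral_congr_fun measurableSet_Ioi fun t (ht : 0 < t) ↦ ?_
        have h1 : 0 < 1 - Real.exp (-(‖k‖ ^ 2 / 4 / t)) := by
          rw [sub_pos, Real.exp_lt_one_iff, neg_lt_zero]
          positivity
        rw [← ENNReal.ofReal_mul (by positivity)]
        refine lintegral_ofReal_eq_of_integral_eq (.of_forall fun y ↦ ?_) ?_ (by positivity)
        · have := hcos ⟪k, y⟫
          simp only [Pi.zero_apply]; positivity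
        · calc _ = ∫ y : V, t ^ ((d + β) / 2 - 1) *
                ((1 - Real.cos ⟪k, y⟫) * Real.exp (-t * ‖y‖ ^ 2)) := by
                congr 1 with y
                ring_nf
            _ = _ := by
                rw [integral_const_mul, integral_one_sub_cos_mul_exp_neg_mul_sq_norm ht,
                  Real.div_rpow Real.pi_pos.le ht.le,
                  show β / 2 - 1 = ((d + β) / 2 - 1) - d / 2 by ring, Real.rpow_sub ht _ (d / 2)]
                change _ * (Real.pi ^ (d / 2) / t ^ (d / 2) * _) = _
                ring
    _ = _ := by
        rw [lintegral_const_mul _ (by fun_prop), lintegral_rpow_mul_one_sub_exp_neg_div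
          (by positivity) (by positivity) (by linarith), ← ENNReal.ofReal_mul (by positivity)]

/-- The normalization constant `c_{n,β}` of the fractional Laplacian:
`c_{n,β} ∫_{ℝⁿ} (1 − cos⟨k,y⟩)|y|^{-n-β} dy = |k|^β`. -/
theorem fractional_laplacian_symbol
    (n : ℕ) (hn : 1 ≤ n) (β : ℝ) (hβ : β ∈ Set.Ioo (0:ℝ) 2)
    (c : ℝ)
    (hc : c = β * Real.Gamma ((n + β) / 2) /
      (2 ^ (1 - β) * Real.pi ^ ((n : ℝ) / 2) * Real.Gamma (1 - β / 2)))
    (k : EuclideanSpace ℝ (Fin n)) :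
    c * ∫ y : EuclideanSpace ℝ (Fin n),
        (1 - Real.cos ⟪k, y⟫) * ‖y‖ ^ (-(n : ℝ) - β)
      = ‖k‖ ^ β := by
  have hβ0 : 0 < β := hβ.1
  rcases eq_or_ne k 0 with rfl | hk
  · simp [Real.zero_rpow hβ0.ne']
  have hΓ1 : 0 < Real.Gamma (1 - β / 2) := Real.Gamma_pos_of_pos (by linarith [hβ.2])
  have hΓ2 : 0 < Real.Gamma ((n + β) / 2) := Real.Gamma_pos_of_pos (by positivity)
  have h := congrArg ENNReal.toReal (ofReal_Gamma_mul_lintegral_one_sub_cos_mul_norm_rpow hβ hk)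
  simp only [finrank_euclideanSpace_fin] at h
  rw [ENNReal.toReal_mul, ENNReal.toReal_ofReal hΓ2.le, ENNReal.toReal_ofReal (by
    have := hΓ1.le
    positivity), ← integral_eq_lintegral_of_nonneg_ae (.of_forall fun y ↦ mul_nonneg
      (sub_nonneg.2 (Real.cos_le_one _)) (by positivity))
      (by fun_prop : Measurable _).aestronglyMeasurable] at h
  have hpow : (‖k‖ ^ 2 / 4) ^ (β / 2) = ‖k‖ ^ β / 2 ^ β := by
    rw [show ‖k‖ ^ 2 / 4 = (‖k‖ / 2) ^ 2 by ring, ← Real.rpow_natCast,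
      ← Real.rpow_mul (by positivity), ← Real.div_rpow (by positivity) (by positivity)]
    congr 1
    push_cast; ring
  rw [hpow] at h
  rw [hc, div_mul_eq_mul_div, mul_assoc, h, Real.rpow_sub two_pos, Real.rpow_one]
  have hΓ1' := hΓ1.ne'
  generalize Real.Gamma (1 - β / 2) = G at hΓ1'
  field_simp
end

section
/- Let n ≥ 1 be an integer, let α ∈ (0,1), and let Φ : ℝⁿ → [0,∞). Suppose p_y : ℝⁿ × (0,∞) → [0,∞) is measurable and for each τ > 0 the function p_y(·, τ) is a probability density on ℝⁿ satisfying ∫_{ℝⁿ} e^{i⟨k,Y⟩} p_y(Y, τ) dY = e^{-τ Φ(k)} for all k ∈ ℝⁿ. Suppose p_e : (0,∞) × (0,∞) → [0,∞) is measurable and satisfies ∫₀^∞ e^{-ut} p_e(τ, t) dt = u^{α−1} e^{-τ u^α} for all τ > 0 and all u > 0. Define p_x(X, t) = ∫₀^∞ p_y(X, τ) p_e(τ, t) dτ. Then for every u > 0 and every k ∈ ℝⁿ, ∫₀^∞ ∫_{ℝⁿ} e^{-ut} e^{i⟨k,X⟩} p_x(X, t) dX dt = u^{α−1} / (u^α +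 Φ(k)). -/
open MeasureTheory
open scoped RealInnerProductSpace

/-- Fourier–Laplace transform of the density of a Lévy process with Fourier exponent `−Φ(k)`
time-changed by the inverse `α`-stable subordinator:
`p̂_x(k,u) = u^{α−1}/(u^α + Φ(k))`. -/
theorem inverse_subordinated_density_fourier_laplace
    (n : ℕ) (hn : 1 ≤ n) (α : ℝ) (hα : α ∈ Set.Ioo (0:ℝ) 1)
    (Φ : EuclideanSpace ℝ (Fin n) → ℝ) (hΦ : ∀ k, 0 ≤ Φ k)
    (p_y : EuclideanSpace ℝ (Fin n) → ℝ → ℝ)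
    (hym : Measurable (Function.uncurry p_y))
    (hy0 : ∀ Y τ, 0 ≤ p_y Y τ)
    (hy1 : ∀ τ > (0:ℝ), ∫ Y : EuclideanSpace ℝ (Fin n), p_y Y τ = 1)
    (hyc : ∀ τ > (0:ℝ), ∀ k : EuclideanSpace ℝ (Fin n),
      ∫ Y : EuclideanSpace ℝ (Fin n),
          Complex.exp (Complex.I * (⟪k, Y⟫ : ℝ)) * (p_y Y τ : ℂ)
        = (Real.exp (-(τ * Φ k)) : ℂ))
    (p_e : ℝ → ℝ → ℝ)
    (hem : Measurable (Function.uncurry p_e))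
    (he0 : ∀ τ t, 0 ≤ p_e τ t)
    (hel : ∀ τ > (0:ℝ), ∀ u > (0:ℝ),
      ∫ s in Set.Ioi (0:ℝ), Real.exp (-(u * s)) * p_e τ s
        = u ^ (α - 1) * Real.exp (-(τ * u ^ α)))
    (p_x : EuclideanSpace ℝ (Fin n) → ℝ → ℝ)
    (hx : ∀ X t, p_x X t = ∫ τ in Set.Ioi (0:ℝ), p_y X τ * p_e τ t) :
    ∀ u > (0:ℝ), ∀ k : EuclideanSpace ℝ (Fin n),
      ∫ t in Set.Ioi (0:ℝ), ∫ X : EuclideanSpace ℝ (Fin n),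
          (Real.exp (-(u * t)) : ℂ) * Complex.exp (Complex.I * (⟪k, X⟫ : ℝ)) * (p_x X t : ℂ)
        = ((u ^ (α - 1) : ℝ) : ℂ) / (((u ^ α : ℝ) : ℂ) + (Φ k : ℂ)) := by
  intro u hu k
  set μ : Measure ℝ := volume.restrict (Set.Ioi 0)
  let ν : Measure (EuclideanSpace ℝ (Fin n)) := volume
  let f : ℝ → ℝ → ℂ := fun τ t ↦ ((Real.exp (-(u * t)) * p_e τ t : ℝ) : ℂ)
  let g : ℝ → EuclideanSpace ℝ (Fin n) → ℂ := fun τ X ↦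
    Complex.exp (Complex.I * (⟪k, X⟫ : ℝ)) * (p_y X τ : ℂ)
  let G : (ℝ × EuclideanSpace ℝ (Fin n)) × ℝ → ℂ := fun q ↦ f q.2 q.1.1 * g q.2 q.1.2
  have hua : 0 < u ^ α := Real.rpow_pos_of_pos hu _
  have hpe : Measurable fun q : (ℝ × EuclideanSpace ℝ (Fin n)) × ℝ ↦ p_e q.2 q.1.1 :=
    hem.comp (measurable_snd.prodMk measurable_fst.fst)
  have hpy : Measurable fun q : (ℝ × EuclideanSpace ℝ (Fin n)) × ℝ ↦ p_y q.1.2 q.2 :=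
    hym.comp (measurable_fst.snd.prodMk measurable_snd)
  have hGm : Measurable G := by
    simp only [G, f, g]
    fun_prop
  have hf_int : ∀ τ > 0, Integrable (f τ) μ := fun τ hτ ↦ by
    have h : Integrable (fun t ↦ Real.exp (-(u * t)) * p_e τ t) μ :=
      Integrable.of_integral_ne_zero (by rw [hel τ hτ u hu]; positivity)
    exact h.ofReal
  have hf_norm : ∀ τ t, ‖f τ t‖ = Real.exp (-(u * t)) * p_e τ t := fun τ t ↦ by
    simp only [f, Complex.norm_real]
    exact Real.norm_of_nonneg (mul_nonneg (Real.exp_pos _).le (he0 τ t))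
  have hg_norm : ∀ τ X, ‖g τ X‖ = p_y X τ := fun τ X ↦ by
    simp only [g, norm_mul, Complex.norm_real, mul_comm Complex.I, Complex.norm_exp_ofReal_mul_I,
      one_mul]
    exact Real.norm_of_nonneg (hy0 X τ)
  have hg_int : ∀ τ > 0, Integrable (g τ) ν := fun τ hτ ↦ by
    have hp : Integrable (fun X ↦ p_y X τ) ν :=
      Integrable.of_integral_ne_zero (by rw [hy1 τ hτ]; exact one_ne_zero)
    refine hp.mono' (Measurable.aestronglyMeasurable ?_) (ae_of_all _ fun X ↦ (hg_norm τ X).le)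
    have : Measurable fun X ↦ p_y X τ := hym.comp (measurable_id.prodMk measurable_const)
    simp only [g]
    fun_prop
  have hexp_int : ∀ c > 0, Integrable (fun τ : ℝ ↦ Real.exp (-c * τ)) μ := fun c hc ↦
    exp_neg_integrableOn_Ioi 0 hc
  have hG : Integrable G ((μ.prod ν).prod μ) := by
    refine (integrable_prod_iff' hGm.aestronglyMeasurable).2 ⟨?_, ?_⟩
    · filter_upwards [ae_restrict_mem measurableSet_Ioi] with τ hτ
      exact (hf_int τ hτ).mul_prod (hg_int τ hτ)
    · refine ((hexp_int _ hua).const_mul (u ^ (α - 1))).congr ?_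
      filter_upwards [ae_restrict_mem measurableSet_Ioi] with τ hτ
      simp only [G, norm_mul]
      rw [integral_prod_mul (fun t ↦ ‖f τ t‖) (fun X ↦ ‖g τ X‖)]
      simp only [hf_norm, hg_norm]
      rw [hel τ hτ u hu, hy1 τ hτ, mul_one, neg_mul, mul_comm τ]
  calc ∫ t, ∫ X, (Real.exp (-(u * t)) : ℂ) * Complex.exp (Complex.I * (⟪k, X⟫ : ℝ))
          * (p_x X t : ℂ) ∂ν ∂μ
      = ∫ t, ∫ X, ∫ τ, G ((t, X), τ) ∂μ ∂ν ∂μ := by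
        congr! 4 with t X
        rw [hx, ← integral_complex_ofReal, ← integral_const_mul]
        congr! 2 with τ
        simp only [G, f, g]
        push_cast
        ring
    _ = ∫ q, ∫ τ, G (q, τ) ∂μ ∂(μ.prod ν) := (integral_prod _ hG.integral_prod_left).symm
    _ = ∫ τ, ∫ q, G (q, τ) ∂(μ.prod ν) ∂μ := integral_integral_swap hG
    _ = ∫ τ, ((u ^ (α - 1) * Real.exp (-(u ^ α + Φ k) * τ) : ℝ) : ℂ) ∂μ := by
        refine integral_congr_ae ?_
        filter_upwards [ae_restrict_mem measurableSet_Ioi] with τ hτ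
        simp only [G]
        rw [integral_prod_mul (f τ) (g τ), hyc τ hτ k, integral_complex_ofReal, hel τ hτ u hu,
          ← Complex.ofReal_mul, mul_assoc, ← Real.exp_add]
        ring_nf
    _ = _ := by
        have hc : 0 < u ^ α + Φ k := add_pos_of_pos_of_nonneg hua (hΦ k)
        rw [integral_complex_ofReal, integral_const_mul,
          integral_exp_mul_Ioi (neg_neg_of_pos hc) 0]
        simp [div_eq_mul_inv, neg_inv]
end
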